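/- (Proposition 1.4, part 1) Let γ > 0 and W''(m) ∈ ℝ be fixed constants. If W''(m) + min_{k ∈ 2πℤ^N, k ≠ 0} ( |k|²/γ² + 1/|k|² ) ≥ 0, then Q_N ≥ W''(m) + min_{k ∈ 2πℤ^N, k ≠ 0} ( |k|²/γ² + 1/|k|² ). -/

import Mathlib

open MeasureTheory Filter Real

noncomputable section

abbrev Pt (N : ℕ) := Fin N → ℝ

/-- partial derivative in direction `i` -/
def pd {N : ℕ} (i : Fin N) (f : Pt N → ℝ) (x : Pt N) : ℝ := fderiv ℝ f x (Pi.single i 1)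

/-- second partial derivative ∂ᵢ∂ⱼ -/
def pd2 {N : ℕ} (i j : Fin N) (f : Pt N → ℝ) : Pt N → ℝ := pd i (pd j f)

/-- the unit cube [0,1]^N, fundamental domain of the torus 𝕋^N -/
def cube (N : ℕ) : Set (Pt N) := Set.Icc 0 1

/-- Laplacian on the torus -/
def lap {N : ℕ} (f : Pt N → ℝ) (x : Pt N) : ℝ := ∑ i, pd2 i i f x

/-- |∇f|² -/
def gradSq {N : ℕ} (f : Pt N → ℝ) (x : Pt N) : ℝ := ∑ i, (pd i f x)^2

/-- 1-periodicity in each coordinate: a function on the torus 𝕋^N -/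
def ZPeriodic {N : ℕ} (f : Pt N → ℝ) : Prop :=
  ∀ (x : Pt N) (i : Fin N), f (x + Pi.single i 1) = f x

/-- min_{k ∈ 2πℤ^N, k ≠ 0} (α - |k|²)² -/
def freqMinPFC (N : ℕ) (α : ℝ) : ℝ :=
  sInf {t : ℝ | ∃ k : Fin N → ℤ, k ≠ 0 ∧ t = (α - 4*π^2 * ∑ i, ((k i : ℝ))^2)^2}

/-- admissible test functions in the definition of P_N -/
def AdmissibleP {N : ℕ} (u : Pt N → ℝ) : Prop :=
  ContDiff ℝ 2 u ∧ ZPeriodic u ∧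
    (∫ x in cube N, (u x)^3) = 1 ∧ (∫ x in cube N, u x) = 0

/-- the product (∫ (αu+Δu)² + c u²) · (∫ u⁴) -/
def Penergy {N : ℕ} (α c : ℝ) (u : Pt N → ℝ) : ℝ :=
  (∫ x in cube N, ((α * u x + lap u x)^2 + c * (u x)^2)) * (∫ x in cube N, (u x)^4)

/-- the optimal constant P_N (with c = W''(m)) -/
def PN (N : ℕ) (α c : ℝ) : ℝ :=
  sInf {p : ℝ | ∃ u : Pt N → ℝ, AdmissibleP u ∧ p = Penergy α c u}

/-- membership in H²_m(𝕋^N) -/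
def MemH2m {N : ℕ} (m : ℝ) (φ : Pt N → ℝ) : Prop :=
  ContDiff ℝ 2 φ ∧ ZPeriodic φ ∧ (∫ x in cube N, φ x) = m

/-- the PFC functional 𝓕 on the torus -/
def Fen {N : ℕ} (α : ℝ) (W : ℝ → ℝ) (φ : Pt N → ℝ) : ℝ :=
  ∫ x in cube N, ((1/2) * (α * φ x + lap φ x)^2 + W (φ x))

/-- ψ = (-Δ)⁻¹ u : the unique zero-average (periodic) solution of -Δψ = u -/
def IsPotential {N : ℕ} (u ψ : Pt N → ℝ) : Prop :=
  ContDiff ℝ 2 ψ ∧ ZPeriodic ψ ∧ (∫ x in cube N, ψ x) = 0 ∧ ∀ x : Pt N, -lap ψ x = u x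

/-- min_{k ∈ 2πℤ^N, k ≠ 0} (|k|²/γ² + 1/|k|²) -/
def freqMinOK (N : ℕ) (γ : ℝ) : ℝ :=
  sInf {t : ℝ | ∃ k : Fin N → ℤ, k ≠ 0 ∧
    t = (4*π^2 * ∑ i, ((k i : ℝ))^2) / γ^2 + 1 / (4*π^2 * ∑ i, ((k i : ℝ))^2)}

/-- admissible test functions in the definition of Q_N -/
def AdmissibleQ {N : ℕ} (u : Pt N → ℝ) : Prop :=
  ContDiff ℝ 1 u ∧ ZPeriodic u ∧
    (∫ x in cube N, (u x)^3) = 1 ∧ (∫ x in cube N, u x) = 0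

/-- the product (∫ γ⁻²|∇u|² + |∇(-Δ)⁻¹u|² + c u²) · (∫ u⁴), where ψ = (-Δ)⁻¹u -/
def Qenergy {N : ℕ} (γ c : ℝ) (u ψ : Pt N → ℝ) : ℝ :=
  (∫ x in cube N, ((1/γ^2) * gradSq u x + gradSq ψ x + c * (u x)^2)) *
    (∫ x in cube N, (u x)^4)

/-- the optimal constant Q_N (with c = W''(m)) -/
def QN (N : ℕ) (γ c : ℝ) : ℝ :=
  sInf {q : ℝ | ∃ u ψ : Pt N → ℝ, AdmissibleQ u ∧ IsPotential u ψ ∧ q = Qenergy γ c u ψ}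

/-- membership in H¹_m(𝕋^N) -/
def MemH1m {N : ℕ} (m : ℝ) (φ : Pt N → ℝ) : Prop :=
  ContDiff ℝ 1 φ ∧ ZPeriodic φ ∧ (∫ x in cube N, φ x) = m

/-- the Ohta–Kawasaki energy, expressed through ψ = (-Δ)⁻¹(φ - m) -/
def Een {N : ℕ} (γ : ℝ) (W : ℝ → ℝ) (φ ψ : Pt N → ℝ) : ℝ :=
  ∫ x in cube N, ((1/(2*γ^2)) * gradSq φ x + (1/2) * gradSq ψ x + W (φ x))

section helpers

/-- the exponential `exp (-2πi k·x)` -/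
def ek {N : ℕ} (k : Fin N → ℤ) (x : Pt N) : ℂ :=
  Complex.exp (∑ i, (-(2 * π * Complex.I * (k i : ℂ)) * (x i : ℂ)))

/-- Fourier coefficient on the cube -/
def FC {N : ℕ} (f : Pt N → ℝ) (k : Fin N → ℤ) : ℂ := ∫ x in cube N, ek k x * (f x : ℂ)

theorem ek_cont {N : ℕ} (k : Fin N → ℤ) : Continuous (ek k) := by
  unfold ek; fun_prop

local instance : MeasureSpace UnitAddCircle := ⟨AddCircle.haarAddCircle⟩

local instance : IsProbabilityMeasure (volume : Measure UnitAddCircle) :=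
  inferInstanceAs (IsProbabilityMeasure AddCircle.haarAddCircle)

theorem cube_ae {N : ℕ} :
    ({x : Pt N | ∀ i, x i ∈ Set.Ioc ((0 : Fin N → ℝ) i) ((0 : Fin N → ℝ) i + 1)} : Set (Pt N))
      =ᵐ[volume] cube N := by
  have h := Measure.univ_pi_Ioc_ae_eq_Icc (μ := fun _ : Fin N => (volume : Measure ℝ))
    (f := (0 : Fin N → ℝ)) (g := 1)
  rw [← volume_pi] at h
  unfold cube
  have e : {x : Pt N | ∀ i, x i ∈ Set.Ioc ((0 : Fin N → ℝ) i) ((0 : Fin N → ℝ) i + 1)}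
      = Set.univ.pi (fun i => Set.Ioc ((0 : Fin N → ℝ) i) ((1 : Fin N → ℝ) i)) := by
    ext x; simp [Set.mem_pi]
  rw [e]
  exact h

/-- extension of a function on the cube to the torus -/
def ext' {N : ℕ} (f : Pt N → ℝ) (y : UnitAddTorus (Fin N)) : ℂ :=
  (f ((UnitAddTorus.measurableEquivPiIoc (0 : Fin N → ℝ) y).1) : ℂ)

theorem ext'_coe {N : ℕ} (f : Pt N → ℝ) (x : Pt N)
    (hx : ∀ i, x i ∈ Set.Ioc ((0 : Fin N → ℝ) i) ((0 : Fin N → ℝ) i + 1)) :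
    ext' f (fun i => (x i : UnitAddCircle)) = (f x : ℂ) := by
  unfold ext'
  congr 2
  have := (UnitAddTorus.measurableEquivPiIoc (0 : Fin N → ℝ)).apply_symm_apply ⟨x, hx⟩
  exact congrArg Subtype.val this

theorem ek_eq {N : ℕ} (k : Fin N → ℤ) (x : Pt N) :
    UnitAddTorus.mFourier (-k) (fun i => (x i : UnitAddCircle)) = ek k x := by
  unfold ek
  simp only [UnitAddTorus.mFourier, ContinuousMap.coe_mk, fourier_coe_apply, Complex.exp_sum]
  refine Finset.prod_congr rfl fun i _ => ?_
  congr 1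
  simp

theorem meas_Ioc {N : ℕ} : MeasurableSet
    {x : Pt N | ∀ i, x i ∈ Set.Ioc ((0 : Fin N → ℝ) i) ((0 : Fin N → ℝ) i + 1)} := by
  have : {x : Pt N | ∀ i, x i ∈ Set.Ioc ((0 : Fin N → ℝ) i) ((0 : Fin N → ℝ) i + 1)}
    = Set.univ.pi (fun i => Set.Ioc ((0 : Fin N → ℝ) i) ((0 : Fin N → ℝ) i + 1)) := by
    ext x; simp [Set.mem_pi]
  rw [this]
  exact MeasurableSet.univ_pi fun i => measurableSet_Ioc

theorem ext'_coeff {N : ℕ} (f : Pt N → ℝ) (k : Fin N → ℤ) :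
    UnitAddTorus.mFourierCoeff (ext' f) k = FC f k := by
  rw [UnitAddTorus.mFourierCoeff_eq_integral _ _ 0, FC, ← setIntegral_congr_set cube_ae]
  refine setIntegral_congr_fun meas_Ioc fun x hx => ?_
  simp only [ext'_coe f x hx, ek_eq, smul_eq_mul]

theorem parseval {N : ℕ} (f : Pt N → ℝ) (hf : Continuous f) :
    HasSum (fun k => ‖FC f k‖ ^ 2) (∫ x in cube N, (f x) ^ 2) := by
  have hmeas : Measurable (ext' f) := by
    unfold ext'
    exact Complex.measurable_ofReal.comp (hf.measurable.comp
      (measurable_subtype_coe.comp (UnitAddTorus.measurableEquivPiIoc (0 : Fin N → ℝ)).measurable))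
  obtain ⟨C, hC⟩ := (isCompact_Icc (a := (0 : Pt N)) (b := 1)).exists_bound_of_continuousOn
    hf.continuousOn
  have hmem : MemLp (ext' f) 2 (volume : Measure (UnitAddTorus (Fin N))) := by
    refine MemLp.of_bound hmeas.aestronglyMeasurable C (Eventually.of_forall fun y => ?_)
    unfold ext'
    rw [Complex.norm_real]
    apply hC
    have := (UnitAddTorus.measurableEquivPiIoc (0 : Fin N → ℝ) y).2
    exact ⟨fun i => (this i).1.le, fun i => by simpa using (this i).2⟩
  have h := UnitAddTorus.hasSum_sq_mFourierCoeff hmem.toLp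
  have e1 : ∀ k, UnitAddTorus.mFourierCoeff (hmem.toLp) k = FC f k := fun k => by
    rw [← ext'_coeff]
    refine integral_congr_ae ?_
    filter_upwards [hmem.coeFn_toLp] with y hy
    rw [hy]
  have e2 : ∫ t, ‖hmem.toLp (ext' f) t‖ ^ 2 = ∫ x in cube N, (f x) ^ 2 := by
    have : ∫ t, ‖hmem.toLp (ext' f) t‖ ^ 2 = ∫ t, ‖ext' f t‖ ^ 2 := by
      refine integral_congr_ae ?_
      filter_upwards [hmem.coeFn_toLp] with y hy
      rw [hy]
    rw [this, UnitAddTorus.integral_preimage _ 0, ← setIntegral_congr_set cube_ae]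
    refine setIntegral_congr_fun meas_Ioc fun x hx => ?_
    simp only [ext'_coe f x hx, Complex.norm_real, Real.norm_eq_abs, sq_abs]
  simp only [e1] at h
  rwa [e2] at h

theorem int_on {N : ℕ} {E : Type*} [NormedAddCommGroup E] {f : Pt N → E} (hf : Continuous f) :
    IntegrableOn f (cube N) := 
  hf.continuousOn.integrableOn_compact isCompact_Icc

/-- the integral of a partial derivative of a periodic function vanishes -/
theorem int_pd_zero {N : ℕ} (i : Fin N) (g : Pt N → ℂ) (hg : ContDiff ℝ 1 g)
    (hp : ∀ x, g (x + Pi.single i 1) = g x) :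
    ∫ x in cube N, fderiv ℝ g x (Pi.single i 1) = 0 := by
  obtain ⟨n, rfl⟩ : ∃ n, N = n + 1 := ⟨N - 1, by have := i.2; omega⟩
  have hc : Continuous (fun x => fderiv ℝ g x (Pi.single i 1)) :=
    (hg.continuous_fderiv (by simp)).clm_apply continuous_const
  have hsum : ∀ x, ∑ j, (if j = i then fderiv ℝ g x else 0) (Pi.single j (1:ℝ))
      = fderiv ℝ g x (Pi.single i 1) := fun x => by
    rw [Finset.sum_eq_single i] <;> simp +contextual
  have h := integral_divergence_of_hasFDerivAt_off_countable' (0 : Pt (n+1)) 1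
    (by intro j; simp) (fun j => if j = i then g else 0)
    (fun j x => if j = i then fderiv ℝ g x else 0) ∅ Set.countable_empty
    (fun j => by
      by_cases hj : j = i
      · simpa [hj] using hg.continuous.continuousOn
      · simpa [hj] using! continuousOn_const)
    (fun x _ j => by
      by_cases hj : j = i
      · simpa [hj] using (hg.differentiable (by simp) x).hasFDerivAt
      · simpa [hj] using! hasFDerivAt_const (0:ℂ) x)
    (by simp only [hsum]; exact int_on hc)
  simp only [hsum] at h
  unfold cube
  rw [h]
  refine Finset.sum_eq_zero fun j _ => ?_
  by_cases hj : j = i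
  · subst hj
    rw [sub_eq_zero]
    congr 1
    funext x
    simp only [if_true]
    rw [← hp (Fin.insertNth j ((0 : Pt (n+1)) j) x)]
    congr 1
    funext l
    rcases Fin.eq_self_or_eq_succAbove j l with rfl | ⟨m, rfl⟩
    · simp
    · simp
  · simp [hj]

theorem ek_contDiff {N : ℕ} (k : Fin N → ℤ) {n : WithTop ℕ∞} : ContDiff ℝ n (ek k) := by
  unfold ek
  refine ContDiff.cexp (ContDiff.sum fun i _ => contDiff_const.mul ?_)
  exact Complex.ofRealCLM.contDiff.comp (contDiff_apply ℝ ℝ i)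

theorem ek_fderiv {N : ℕ} (k : Fin N → ℤ) (i : Fin N) (x : Pt N) :
    fderiv ℝ (ek k) x (Pi.single i 1) = -(2 * π * Complex.I * (k i : ℂ)) * ek k x := by
  have h1 : HasFDerivAt (fun x : Pt N => ∑ i, (-(2 * π * Complex.I * (k i : ℂ)) * (x i : ℂ)))
      (∑ i, (-(2 * π * Complex.I * (k i : ℂ))) • 
        (Complex.ofRealCLM.comp (ContinuousLinearMap.proj (R := ℝ) (φ := fun _ : Fin N => ℝ) i))) x := by
    refine HasFDerivAt.fun_sum fun j _ => ?_
    refine HasFDerivAt.const_mul ?_ _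
    exact (Complex.ofRealCLM.comp (ContinuousLinearMap.proj (R := ℝ) (φ := fun _ : Fin N => ℝ) j)).hasFDerivAt
  have h2 := h1.cexp
  rw [show fderiv ℝ (ek k) x = _ from h2.fderiv]
  simp only [smul_apply, sum_apply, smul_eq_mul,
    ContinuousLinearMap.comp_apply, ContinuousLinearMap.proj_apply, Complex.ofRealCLM_apply]
  have hs : ∑ j, -(2 * π * Complex.I * (k j : ℂ)) * (((Pi.single i (1 : ℝ) : Pt N) j : ℝ) : ℂ)
      = -(2 * π * Complex.I * (k i : ℂ)) := by
    rw [Finset.sum_eq_single i]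
    · simp
    · intro j _ hj; simp [hj]
    · simp
  rw [hs, mul_comm, ek]

theorem ek_periodic {N : ℕ} (k : Fin N → ℤ) (i : Fin N) (x : Pt N) :
    ek k (x + Pi.single i 1) = ek k x := by
  rw [← ek_eq, ← ek_eq]
  congr 1
  funext j
  by_cases hj : j = i
  · subst hj; simp
  · simp [hj]

theorem pd_cont {N : ℕ} (i : Fin N) {f : Pt N → ℝ} (hf : ContDiff ℝ 1 f) :
    Continuous (pd i f) :=
  (hf.continuous_fderiv (by simp)).clm_apply continuous_const

theorem pd_contDiff {N : ℕ} (i : Fin N) {f : Pt N → ℝ} (hf : ContDiff ℝ 2 f) :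
    ContDiff ℝ 1 (pd i f) :=
  (hf.fderiv_right (m := 1) (by norm_num)).clm_apply contDiff_const

theorem pd_periodic {N : ℕ} (i : Fin N) {f : Pt N → ℝ} (hf : ZPeriodic f) :
    ZPeriodic (pd i f) := by
  intro x j
  unfold pd
  rw [← fderiv_comp_add_right]
  congr 2
  funext y
  exact hf y j

theorem FC_pd {N : ℕ} (i : Fin N) (f : Pt N → ℝ) (hf : ContDiff ℝ 1 f) (hp : ZPeriodic f)
    (k : Fin N → ℤ) : FC (pd i f) k = (2 * π * Complex.I * (k i : ℂ)) * FC f k := by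
  have hfc : ContDiff ℝ 1 (fun x => (f x : ℂ)) := Complex.ofRealCLM.contDiff.comp hf
  have h := int_pd_zero i (fun x => ek k x * (f x : ℂ)) ((ek_contDiff k).mul hfc)
    (fun x => by simp only [ek_periodic, hp x i])
  have e : ∀ x, fderiv ℝ (fun x => ek k x * (f x : ℂ)) x (Pi.single i 1)
      = ek k x * (pd i f x : ℂ) - (2 * π * Complex.I * (k i : ℂ)) * (ek k x * (f x : ℂ)) := by
    intro x
    have h1 : HasFDerivAt (ek k) (fderiv ℝ (ek k) x) x :=
      ((ek_contDiff k (n := 1)).differentiable (by simp) x).hasFDerivAt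
    have h2 : HasFDerivAt (fun x => (f x : ℂ)) (Complex.ofRealCLM.comp (fderiv ℝ f x)) x :=
      Complex.ofRealCLM.hasFDerivAt.comp x (hf.differentiable (by simp) x).hasFDerivAt
    rw [(h1.fun_mul h2).fderiv]
    simp [ek_fderiv, pd]
    ring
  simp only [e] at h
  have hi1 : IntegrableOn (fun x => ek k x * (pd i f x : ℂ)) (cube N) :=
    int_on ((ek_cont k).mul (Complex.continuous_ofReal.comp (pd_cont i hf)))
  have hi2 : IntegrableOn (fun x => ek k x * (f x : ℂ)) (cube N) :=
    int_on ((ek_cont k).mul (Complex.continuous_ofReal.comp hf.continuous))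
  rw [integral_sub hi1 (hi2.const_mul _), integral_const_mul, sub_eq_zero] at h
  exact h

theorem FC_lap {N : ℕ} (u ψ : Pt N → ℝ) (h : IsPotential u ψ) (k : Fin N → ℤ) :
    FC u k = ((4 * π ^ 2 * ∑ i, ((k i : ℝ)) ^ 2 : ℝ) : ℂ) * FC ψ k := by
  obtain ⟨h1, h2, -, h4⟩ := h
  have hi : ∀ i, FC (pd i (pd i ψ)) k = -((4 * π ^ 2 * (k i : ℝ) ^ 2 : ℝ) : ℂ) * FC ψ k := by
    intro i
    rw [FC_pd i _ (pd_contDiff i h1) (pd_periodic i h2), FC_pd i _ (h1.of_le (by norm_num)) h2]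
    push_cast
    linear_combination (4 * π ^ 2 * (k i : ℂ) ^ 2 * FC ψ k) * Complex.I_sq
  have hs : FC u k = -∑ i, FC (pd i (pd i ψ)) k := by
    unfold FC
    rw [← integral_finsetSum, ← integral_neg]
    · congr 1
      funext x
      rw [← h4 x, ← Finset.mul_sum]
      simp [lap, pd2]
    · intro i _
      exact int_on ((ek_cont k).mul
        (Complex.continuous_ofReal.comp (pd_cont i (pd_contDiff i h1))))
  rw [hs]
  simp only [hi]
  rw [← Finset.sum_mul, Finset.sum_neg_distrib, Finset.mul_sum]
  push_cast
  ring

theorem freq_le {N : ℕ} (γ : ℝ) (k : Fin N → ℤ) (hk : k ≠ 0) :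
    freqMinOK N γ ≤ (4*π^2 * ∑ i, ((k i : ℝ))^2) / γ^2 + 1 / (4*π^2 * ∑ i, ((k i : ℝ))^2) := by
  refine csInf_le ⟨0, ?_⟩ ⟨k, hk, rfl⟩
  rintro t ⟨k, -, rfl⟩
  positivity

theorem quad_bound {N : ℕ} (γ c : ℝ) (u ψ : Pt N → ℝ) (hu : AdmissibleQ u)
    (hψ : IsPotential u ψ) :
    (c + freqMinOK N γ) * ∫ x in cube N, (u x) ^ 2 ≤
      ∫ x in cube N, ((1/γ^2) * gradSq u x + gradSq ψ x + c * (u x)^2) := by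
  obtain ⟨u1, u2, -, u4⟩ := hu
  have p1 : ContDiff ℝ 1 ψ := hψ.1.of_le (by norm_num)
  have p2 := hψ.2.1
  have hg : ∀ f : Pt N → ℝ, ContDiff ℝ 1 f → ZPeriodic f →
      HasSum (fun k : Fin N → ℤ => (4*π^2 * ∑ i, ((k i : ℝ))^2) * ‖FC f k‖ ^ 2)
        (∫ x in cube N, gradSq f x) := by
    intro f hf hp
    have := hasSum_sum (s := Finset.univ) fun i _ => parseval (pd i f) (pd_cont i hf)
    unfold gradSq
    rw [integral_finsetSum _ fun i _ => int_on (f := fun x => (pd i f x)^2) ((pd_cont i hf).pow 2)]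
    convert this using 2 with k
    rw [Finset.mul_sum, Finset.sum_mul]
    refine Finset.sum_congr rfl fun i _ => ?_
    rw [FC_pd i f hf hp, norm_mul, mul_pow]
    simp [abs_of_pos Real.pi_pos, mul_pow]
    left; left; ring
  have gc : ∀ f : Pt N → ℝ, ContDiff ℝ 1 f → Continuous (gradSq f) := fun f hf => by
    unfold gradSq
    exact continuous_finsetSum _ fun i _ => (pd_cont i hf).pow 2
  have hU := parseval u u1.continuous
  have hR := (((hg u u1 u2).mul_left (1/γ^2)).add (hg ψ p1 p2)).add (hU.mul_left c)
  rw [integral_add, integral_add, integral_const_mul, integral_const_mul]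
  rotate_left
  · exact (int_on (gc u u1)).const_mul _
  · exact int_on (gc ψ p1)
  · exact ((int_on (gc u u1)).const_mul _).add (int_on (gc ψ p1))
  · exact (int_on (u1.continuous.pow 2)).const_mul _
  refine hasSum_le (fun k => ?_) (hU.mul_left (c + freqMinOK N γ)) hR
  by_cases hk : k = 0
  · subst hk
    have : FC u 0 = 0 := by
      unfold FC ek
      simp only [Pi.zero_apply, Int.cast_zero, mul_zero, neg_zero, zero_mul,
        Finset.sum_const_zero, Complex.exp_zero, one_mul]
      rw [integral_complex_ofReal, u4]; simp
    simp [this]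
  · have hf := freq_le γ k hk
    rw [FC_lap u ψ hψ k, norm_mul, Complex.norm_real, mul_pow, Real.norm_eq_abs, sq_abs]
    have hS : 0 < 4*π^2 * ∑ i, ((k i : ℝ))^2 := by
      have : 0 < ∑ i, ((k i : ℝ))^2 := by
        obtain ⟨i, hi⟩ := Function.ne_iff.1 hk
        refine Finset.sum_pos' (fun _ _ => by positivity) ⟨i, Finset.mem_univ _, ?_⟩
        have : (k i : ℝ) ≠ 0 := by exact_mod_cast hi
        positivity
      positivity
    set S := 4*π^2 * ∑ i, ((k i : ℝ))^2
    set P := ‖FC ψ k‖ ^ 2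
    have hP : 0 ≤ P := by positivity
    have : freqMinOK N γ * (S^2 * P) ≤ (S / γ^2 + 1 / S) * (S^2 * P) := by gcongr
    have e : (S / γ^2 + 1 / S) * (S^2 * P) = 1 / γ^2 * (S * (S^2 * P)) + S * P := by
      field_simp
    linarith

theorem cs_bound {N : ℕ} (u : Pt N → ℝ) (hc : Continuous u) (h3 : ∫ x in cube N, (u x)^3 = 1) :
    1 ≤ (∫ x in cube N, (u x)^2) * ∫ x in cube N, (u x)^4 := by
  have h : ∀ t : ℝ, 0 ≤ (∫ x in cube N, (u x)^2) * (t * t) + 2 * t + ∫ x in cube N, (u x)^4 := by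
    intro t
    have h0 : 0 ≤ ∫ x in cube N, (t * u x + (u x)^2)^2 :=
      integral_nonneg fun x => by positivity
    have e : ∀ x, (t * u x + (u x)^2)^2 = (t * t) * (u x)^2 + (2 * t) * (u x)^3 + (u x)^4 :=
      fun x => by ring
    simp only [e] at h0
    rw [integral_add, integral_add, integral_const_mul, integral_const_mul, h3] at h0
    · linarith
    · exact int_on (by fun_prop)
    · exact int_on (by fun_prop)
    · exact int_on (by fun_prop)
    · exact int_on (by fun_prop)
  have := discrim_le_zero h
  unfold discrim at this
  linarith

theorem int_cube_eval {N : ℕ} (i : Fin N) (g : ℝ → ℝ) (hg : Continuous g) :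
    ∫ x in cube N, g (x i) = ∫ t in (0:ℝ)..1, g t := by
  have hc : cube N = Set.univ.pi fun _ => Set.Icc (0:ℝ) 1 := by
    unfold cube; rw [← Set.pi_univ_Icc]; rfl
  have : IsProbabilityMeasure ((volume : Measure ℝ).restrict (Set.Icc 0 1)) := ⟨by simp⟩
  rw [hc, volume_pi, Measure.restrict_pi_pi]
  have h := measurePreserving_eval (fun _ : Fin N => (volume : Measure ℝ).restrict (Set.Icc 0 1)) i
  rw [intervalIntegral.integral_of_le zero_le_one, ← integral_Icc_eq_integral_Ioc]
  conv_rhs => rw [← h.map_eq]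
  rw [integral_map h.measurable.aemeasurable hg.aestronglyMeasurable]

theorem int_cos (n : ℕ) (hn : n ≠ 0) : ∫ t in (0:ℝ)..1, cos (n * (2 * π * t)) = 0 := by
  have h : (n : ℝ) * (2 * π) ≠ 0 := by positivity
  have e : ∀ t : ℝ, (n : ℝ) * (2 * π * t) = (n * (2 * π)) * t := fun t => by ring
  simp only [e]
  rw [intervalIntegral.integral_comp_mul_left (fun t => cos t) h]
  have hs : sin ((n : ℝ) * (2 * π)) = 0 := by
    have := Real.sin_nat_mul_pi (n * 2)
    push_cast at this
    rwa [mul_assoc] at this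
  simp [hs]

theorem cos_cube (t : ℝ) : (cos (1 * t) + cos (2 * t)) ^ 3 = 3/4 + 9/4 * cos (1 * t)
    + 9/4 * cos (2 * t) + cos (3 * t) + 3/4 * cos (4 * t) + 3/4 * cos (5 * t)
    + 1/4 * cos (6 * t) := by
  have h4 : cos (4 * t) = 2 * cos (2 * t) ^ 2 - 1 := by
    rw [← cos_two_mul]; congr 1; ring
  have h6 : cos (6 * t) = 2 * cos (3 * t) ^ 2 - 1 := by
    rw [← cos_two_mul]; congr 1; ring
  have h5 : cos (5 * t) = 2 * cos (3 * t) * cos (2 * t) - cos t := by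
    have a := cos_add (3 * t) (2 * t)
    have b := cos_sub (3 * t) (2 * t)
    rw [show 3 * t + 2 * t = 5 * t by ring] at a
    rw [show 3 * t - 2 * t = t by ring] at b
    linarith
  rw [h4, h5, h6, cos_three_mul, cos_two_mul, one_mul]
  ring

theorem pd_eval {N : ℕ} (i j : Fin N) (g g' : ℝ → ℝ) (h : ∀ t, HasDerivAt g (g' t) t) :
    pd j (fun x : Pt N => g (x i)) = fun x => if j = i then g' (x i) else 0 := by
  funext x
  unfold pd
  have h1 : HasFDerivAt (fun x : Pt N => x i)
    (ContinuousLinearMap.proj (R := ℝ) (φ := fun _ : Fin N => ℝ) i) x :=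
    (ContinuousLinearMap.proj (R := ℝ) (φ := fun _ : Fin N => ℝ) i).hasFDerivAt
  have h2 := (h (x i)).comp_hasFDerivAt x h1
  rw [show fderiv ℝ (fun x : Pt N => g (x i)) x = _ from h2.fderiv]
  by_cases hj : j = i
  · subst hj; simp
  · have : i ≠ j := fun h => hj h.symm
    simp [hj, this]

theorem lap_eval {N : ℕ} (i : Fin N) (g g' g'' : ℝ → ℝ) (h : ∀ t, HasDerivAt g (g' t) t)
    (h' : ∀ t, HasDerivAt g' (g'' t) t) (x : Pt N) :
    lap (fun x : Pt N => g (x i)) x = g'' (x i) := by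
  unfold lap pd2
  rw [Finset.sum_eq_single i]
  · rw [pd_eval i i g g' h]
    simp only [if_true]
    rw [pd_eval i i g' g'' h']
    simp
  · intro j _ hj
    rw [pd_eval i j g g' h]
    simp [hj, pd]
  · simp

theorem exists_test {N : ℕ} (hN : 0 < N) :
    ∃ u ψ : Pt N → ℝ, AdmissibleQ u ∧ IsPotential u ψ := by
  obtain ⟨a, ha⟩ : ∃ a : ℝ, a ^ 3 = 4 / 3 := by
    refine ⟨(4/3 : ℝ) ^ ((1:ℝ)/3), ?_⟩
    rw [← Real.rpow_natCast, ← Real.rpow_mul (by norm_num)]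
    norm_num
  have hπ : π ≠ 0 := Real.pi_ne_zero
  let i : Fin N := ⟨0, hN⟩
  let C : ℕ → ℝ → ℝ := fun n t => cos (n * (2 * π * t))
  have hC : ∀ n, Continuous (C n) := fun n => by unfold C; fun_prop
  have hCi : ∀ n, IntervalIntegrable (C n) volume 0 1 := fun n => (hC n).intervalIntegrable _ _
  have hCz : ∀ n, n ≠ 0 → ∫ t in (0:ℝ)..1, C n t = 0 := int_cos
  have hCd : ∀ n m, ContDiff ℝ m (C n) := fun n m => by unfold C; fun_prop
  have hCp : ∀ n t, C n (t + 1) = C n t := fun n t => by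
    unfold C
    rw [show (n:ℝ) * (2 * π * (t + 1)) = n * (2 * π * t) + n * (2 * π) by ring,
      Real.cos_add_nat_mul_two_pi]
  have hlin : ∀ p q : ℝ, ∫ t in (0:ℝ)..1, (p * C 1 t + q * C 2 t) = 0 := fun p q => by
    rw [intervalIntegral.integral_add ((hCi 1).const_mul p) ((hCi 2).const_mul q),
      intervalIntegral.integral_const_mul, intervalIntegral.integral_const_mul,
      hCz 1 (by norm_num), hCz 2 (by norm_num)]
    simp
  have hper : ∀ p q : ℝ, ZPeriodic (fun x : Pt N => p * C 1 (x i) + q * C 2 (x i)) := by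
    intro p q x j
    by_cases hj : i = j
    · subst hj; simp [hCp]
    · simp [Pi.single_eq_of_ne hj]
  have hcd : ∀ (p q : ℝ) (m : WithTop ℕ∞),
      ContDiff ℝ m (fun x : Pt N => p * C 1 (x i) + q * C 2 (x i)) := fun p q m =>
    (contDiff_const.mul ((hCd 1 m).comp (contDiff_apply ℝ ℝ i))).add
      (contDiff_const.mul ((hCd 2 m).comp (contDiff_apply ℝ ℝ i)))
  have hcont : ∀ p q : ℝ, Continuous (fun t => p * C 1 t + q * C 2 t) := fun p q =>
    (continuous_const.mul (hC 1)).add (continuous_const.mul (hC 2))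
  refine ⟨fun x => a * C 1 (x i) + a * C 2 (x i),
    fun x => (a / (4 * π^2)) * C 1 (x i) + (a / (16 * π^2)) * C 2 (x i),
    ⟨hcd _ _ _, hper _ _, ?_, ?_⟩, hcd _ _ _, hper _ _, ?_, ?_⟩
  · rw [int_cube_eval i (fun t => (a * C 1 t + a * C 2 t)^3) ((hcont a a).pow 3)]
    have e : ∀ t, (a * C 1 t + a * C 2 t)^3 = a^3 * (3/4) + a^3 * (9/4) * C 1 t
        + a^3 * (9/4) * C 2 t + a^3 * C 3 t + a^3 * (3/4) * C 4 t + a^3 * (3/4) * C 5 t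
        + a^3 * (1/4) * C 6 t := fun t => by
      have := cos_cube (2 * π * t)
      simp only [C]
      push_cast
      linear_combination a^3 * this
    simp only [e]
    have I := fun (n : ℕ) (p : ℝ) => (hCi n).const_mul p
    have I0 : IntervalIntegrable (fun _ : ℝ => a^3 * (3/4)) volume 0 1 :=
      intervalIntegrable_const
    rw [intervalIntegral.integral_add (((((I0.add (I 1 _)).add (I 2 _)).add (I 3 _)).add (I 4 _)).add (I 5 _)) (I 6 _),
      intervalIntegral.integral_add ((((I0.add (I 1 _)).add (I 2 _)).add (I 3 _)).add (I 4 _)) (I 5 _),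
      intervalIntegral.integral_add (((I0.add (I 1 _)).add (I 2 _)).add (I 3 _)) (I 4 _),
      intervalIntegral.integral_add ((I0.add (I 1 _)).add (I 2 _)) (I 3 _),
      intervalIntegral.integral_add (I0.add (I 1 _)) (I 2 _),
      intervalIntegral.integral_add I0 (I 1 _)]
    simp only [intervalIntegral.integral_const_mul]
    rw [hCz 1 (by norm_num), hCz 2 (by norm_num), hCz 3 (by norm_num), hCz 4 (by norm_num),
      hCz 5 (by norm_num), hCz 6 (by norm_num), ha]
    norm_num
  · rw [int_cube_eval i (fun t => a * C 1 t + a * C 2 t) (hcont _ _)]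
    exact hlin _ _
  · rw [int_cube_eval i (fun t => (a / (4 * π^2)) * C 1 t + (a / (16 * π^2)) * C 2 t) (hcont _ _)]
    exact hlin _ _
  · intro x
    have hl : ∀ (n : ℕ) t, HasDerivAt (fun t : ℝ => (n:ℝ) * (2 * π * t)) (n * (2 * π)) t :=
      fun n t => by
        simpa using (((hasDerivAt_id t).const_mul (2 * π)).const_mul (n : ℝ))
    have hD : ∀ (n : ℕ) t, HasDerivAt (C n) (-sin (n * (2 * π * t)) * (n * (2 * π))) t :=
      fun n t => (hl n t).cos
    have hD2 : ∀ (n : ℕ) t, HasDerivAt (fun t => -sin (n * (2 * π * t)) * (n * (2 * π)))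
        (-(cos (n * (2 * π * t)) * (n * (2 * π))) * (n * (2 * π))) t :=
      fun n t => ((hl n t).sin.fun_neg).mul_const _
    rw [lap_eval i (fun t => (a / (4 * π^2)) * C 1 t + (a / (16 * π^2)) * C 2 t) _ _
      (fun t => ((hD 1 t).const_mul _).fun_add ((hD 2 t).const_mul _))
      (fun t => ((hD2 1 t).const_mul _).fun_add ((hD2 2 t).const_mul _))]
    simp only [C]
    push_cast
    field_simp
    ring

end helpers

/-- Proposition 1.4, part 1. -/
theorem prop_QN_lower_bound (N : ℕ) (hN : 0 < N) (γ c : ℝ) (hγ : 0 < γ)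
    (hstab : 0 ≤ c + freqMinOK N γ) :
    QN N γ c ≥ c + freqMinOK N γ := by
  obtain ⟨u₀, ψ₀, h1, h2⟩ := exists_test hN
  refine le_csInf ⟨_, u₀, ψ₀, h1, h2, rfl⟩ ?_
  rintro q ⟨u, ψ, hu, hψ, rfl⟩
  have hq := quad_bound γ c u ψ hu hψ
  have hcs := cs_bound u hu.1.continuous hu.2.2.1
  have h4 : 0 ≤ ∫ x in cube N, (u x)^4 := integral_nonneg fun x => by positivity
  unfold Qenergy
  calc c + freqMinOK N γ ≤ (c + freqMinOK N γ) *
        ((∫ x in cube N, (u x)^2) * ∫ x in cube N, (u x)^4) := le_mul_of_one_le_right hstab hcs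
    _ = ((c + freqMinOK N γ) * ∫ x in cube N, (u x)^2) * ∫ x in cube N, (u x)^4 := by ring
    _ ≤ _ := mul_le_mul_of_nonneg_right hq h4

end
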